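/- Let d ≥ 1, r > 0, let ‖·‖ be a norm on ℝ^d with V_d the volume of its unit ball, let X have density f_X with h(X) finite and H(⌊X⌋) < ∞, and for each D > 0 let Z_D be independent of X with density f_{Z_D}(z) = (d/r)^{d/r−1}·(V_d·Γ(d/r)·D^{d/r})^{-1}·exp(−(d/(rD))‖z‖^r). Then limsup_{D↓0} h(X + Z_D) ≤ h(X), where X + Z_D has density the convolution of f_X and f_{Z_D}. -/

import Mathlib

open MeasureTheory ProbabilityTheory Real Filter Topology
open scoped ENNReal

/-- Componentwise integer part of a vector in ℝ^d. -/
noncomputable def intFloor (d : ℕ) (x : Fin d → ℝ) : Fin d → ℤ := fun i => ⌊x i⌋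

/-- Discrete (Shannon) entropy, in nats, of the random element `V` under `P`,
valued in `[0,∞]`. -/
noncomputable def discEnt {Ω α : Type*} [MeasurableSpace Ω] (P : Measure Ω) (V : Ω → α) : ℝ≥0∞ :=
  ∑' a : α, ENNReal.ofReal (Real.negMulLog (P (V ⁻¹' {a})).toReal)

/-- Differential entropy of a measure on ℝ^d (w.r.t. Lebesgue measure),
as a Bochner integral of `-f log f` where `f` is the Radon–Nikodym density. -/
noncomputable def diffEnt {d : ℕ} (μ : Measure (Fin d → ℝ)) : ℝ :=
  -∫ x, ((μ.rnDeriv volume x).toReal) * Real.log ((μ.rnDeriv volume x).toReal)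

open Classical in
/-- Kullback–Leibler divergence of `μ` w.r.t. `ν`, valued in `[0,∞]`. -/
noncomputable def klDiv {α : Type*} [MeasurableSpace α] (μ ν : Measure α) : ℝ≥0∞ :=
  if μ ≪ ν ∧ Integrable (llr μ ν) μ then ENNReal.ofReal (∫ x, llr μ ν x ∂μ) else ⊤

/-- The density of `X + s • Z` when `X` and `Z` are independent with densities `f` and `φ`. -/
noncomputable def addScaledDensity {d : ℕ} (f φ : (Fin d → ℝ) → ℝ) (s : ℝ) (x : Fin d → ℝ) : ℝ :=
  ∫ u, f (x - s • u) * φ u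

theorem diffEnt_withDensity {d : ℕ} {f : (Fin d → ℝ) → ℝ} (hf0 : ∀ x, 0 ≤ f x)
    (hfm : Measurable f) :
    diffEnt (volume.withDensity fun x => ENNReal.ofReal (f x)) =
      -∫ x, f x * Real.log (f x) := by
  unfold diffEnt
  congr 1
  refine integral_congr_ae ?_
  filter_upwards [Measure.rnDeriv_withDensity volume hfm.ennreal_ofReal] with x hx
  rw [hx, ENNReal.toReal_ofReal (hf0 x)]

theorem mul_log_sub_mul_log_sub_add_nonneg {a b : ℝ} (ha : 0 ≤ a) (hb : 0 < b) :
    0 ≤ a * Real.log a - a * Real.log b - a + b := by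
  rcases ha.eq_or_lt with rfl | ha
  · simpa using hb.le
  have h := mul_le_mul_of_nonneg_left (Real.log_le_sub_one_of_pos (div_pos hb ha)) ha.le
  rw [Real.log_div hb.ne' ha.ne', mul_sub, mul_sub, mul_div_cancel₀ _ ha.ne'] at h
  linarith

section Smoothing

variable {d : ℕ} {f φ w : (Fin d → ℝ) → ℝ}

theorem measurable_addScaledDensity_uncurry (hfm : Measurable f) (hφm : Measurable φ) (s : ℝ) :
    Measurable fun p : (Fin d → ℝ) × (Fin d → ℝ) => f (p.1 - s • p.2) * φ p.2 :=
  (hfm.comp (by fun_prop)).mul (hφm.comp measurable_snd)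

theorem measurable_addScaledDensity (hfm : Measurable f) (hφm : Measurable φ) (s : ℝ) :
    Measurable (addScaledDensity f φ s) :=
  (measurable_addScaledDensity_uncurry hfm hφm s).stronglyMeasurable.integral_prod_right.measurable

theorem addScaledDensity_nonneg (hf0 : ∀ x, 0 ≤ f x) (hφ0 : ∀ x, 0 ≤ φ x) (s : ℝ)
    (x : Fin d → ℝ) : 0 ≤ addScaledDensity f φ s x :=
  integral_nonneg fun _ => mul_nonneg (hf0 _) (hφ0 _)

theorem integrable_comp_sub_smul (hf : Integrable f) {s : ℝ} (hs : s ≠ 0) (x : Fin d → ℝ) :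
    Integrable fun u => f (x - s • u) :=
  (integrable_comp_smul_iff volume (fun u => f (x - u)) hs).2 (hf.comp_sub_left x)

theorem addScaledDensity_le (hf0 : ∀ x, 0 ≤ f x) (hf : Integrable f) (hφ0 : ∀ x, 0 ≤ φ x)
    {M : ℝ} (hM : ∀ x, φ x ≤ M) {s : ℝ} (hs : s ≠ 0) (x : Fin d → ℝ) :
    addScaledDensity f φ s x ≤ |(s ^ d)⁻¹| * (∫ y, f y) * M := by
  have h : ∫ u, f (x - s • u) = |(s ^ d)⁻¹| * ∫ y, f y := by
    rw [Measure.integral_comp_smul volume (fun u => f (x - u)), integral_sub_left_eq_self]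
    simp
  rw [← h, ← integral_mul_const]
  refine integral_mono_of_nonneg (.of_forall fun u => mul_nonneg (hf0 _) (hφ0 _))
    ((integrable_comp_sub_smul hf hs x).mul_const M)
    (.of_forall fun u => mul_le_mul_of_nonneg_left (hM u) (hf0 _))

theorem integrable_mul_comp_add (hf0 : ∀ x, 0 ≤ f x) (hfm : Measurable f) (hf : Integrable f)
    (hwm : Measurable w) {C : ℝ} (hw : ∀ x z, |w (x + z) - w x| ≤ C * ‖z‖)
    (hfw : Integrable fun x => f x * w x) (z : Fin d → ℝ) :
    Integrable fun x => f x * w (x + z) := by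
  have h : Integrable fun x => f x * (w (x + z) - w x) :=
    (hf.mul_const (C * ‖z‖)).mono' (by fun_prop)
      (.of_forall fun x => by
        rw [norm_mul, Real.norm_of_nonneg (hf0 x)]
        exact mul_le_mul_of_nonneg_left (hw x z) (hf0 x))
  refine (h.add hfw).congr (.of_forall fun x => ?_)
  simp only [Pi.add_apply]
  ring

theorem integrable_smoothing_prod (hf0 : ∀ x, 0 ≤ f x) (hfm : Measurable f) (hf : Integrable f)
    (hφ0 : ∀ x, 0 ≤ φ x) (hφm : Measurable φ) (hφ : Integrable φ)
    (hφ1 : Integrable fun u => ‖u‖ * φ u)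
    (hwm : Measurable w) {C : ℝ} (hw : ∀ x z, |w (x + z) - w x| ≤ C * ‖z‖)
    (hfw : Integrable fun x => f x * w x) (s : ℝ) :
    Integrable (fun p : (Fin d → ℝ) × (Fin d → ℝ) => f (p.1 - s • p.2) * φ p.2 * w p.1)
      (volume.prod volume) := by
  have hm : Measurable fun p : (Fin d → ℝ) × (Fin d → ℝ) => f (p.1 - s • p.2) * φ p.2 * w p.1 :=
    (measurable_addScaledDensity_uncurry hfm hφm s).mul (hwm.comp measurable_fst)
  have hfib (u : Fin d → ℝ) : Integrable fun x => f x * φ u * w (x + s • u) :=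
    ((integrable_mul_comp_add hf0 hfm hf hwm hw hfw (s • u)).mul_const (φ u)).congr
      (.of_forall fun x => by ring)
  have htr (u : Fin d → ℝ) : (fun x => f (x - s • u) * φ u * w x) =
      fun x => (fun y => f y * φ u * w (y + s • u)) (x - s • u) := by
    ext x; simp
  refine (integrable_prod_iff' hm.aestronglyMeasurable).2 ⟨.of_forall fun u => ?_, ?_⟩
  · simp only [htr u]
    exact (hfib u).comp_sub_right (s • u)
  · have hb : Integrable fun u => φ u * (∫ x, ‖f x * w x‖) + ‖u‖ * φ u * (C * |s| * ∫ x, f x) :=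
      (hφ.mul_const _).add (hφ1.mul_const _)
    refine hb.mono' hm.norm.stronglyMeasurable.integral_prod_left.aestronglyMeasurable
      (.of_forall fun u => ?_)
    rw [Real.norm_of_nonneg (integral_nonneg fun _ => norm_nonneg _)]
    have e : ∫ x, ‖f (x - s • u) * φ u * w x‖ = ∫ x, ‖f x * φ u * w (x + s • u)‖ := by
      rw [← integral_sub_right_eq_self (fun x => ‖f x * φ u * w (x + s • u)‖) (s • u)]
      simp
    simp only [e]
    calc ∫ x, ‖f x * φ u * w (x + s • u)‖
        ≤ ∫ x, (φ u * ‖f x * w x‖ + ‖u‖ * φ u * (C * |s|) * f x) := by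
          refine integral_mono (hfib u).norm
            ((hfw.norm.const_mul _).add (hf.const_mul _)) fun x => ?_
          have h1 : |w (x + s • u)| ≤ |w x| + C * (|s| * ‖u‖) := by
            have := hw x (s • u)
            rw [norm_smul, Real.norm_eq_abs] at this
            have := abs_sub_abs_le_abs_sub (w (x + s • u)) (w x)
            linarith
          simp only [norm_mul, Real.norm_eq_abs, abs_of_nonneg (hf0 x), abs_of_nonneg (hφ0 u)]
          have := mul_le_mul_of_nonneg_left h1 (mul_nonneg (hf0 x) (hφ0 u))
          linarith
      _ = _ := by
          rw [integral_add (hfw.norm.const_mul _) (hf.const_mul _), integral_const_mul,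
            integral_const_mul]
          ring

theorem integrable_addScaledDensity_mul (hf0 : ∀ x, 0 ≤ f x) (hfm : Measurable f)
    (hf : Integrable f) (hφ0 : ∀ x, 0 ≤ φ x) (hφm : Measurable φ) (hφ : Integrable φ)
    (hφ1 : Integrable fun u => ‖u‖ * φ u)
    (hwm : Measurable w) {C : ℝ} (hw : ∀ x z, |w (x + z) - w x| ≤ C * ‖z‖)
    (hfw : Integrable fun x => f x * w x) (s : ℝ) :
    Integrable fun x => addScaledDensity f φ s x * w x := by
  refine (integrable_smoothing_prod hf0 hfm hf hφ0 hφm hφ hφ1 hwm hw hfw s).integral_prod_left.congr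
    (.of_forall fun x => ?_)
  simp only [addScaledDensity]
  rw [integral_mul_const]

theorem abs_integral_addScaledDensity_mul_sub_le (hf0 : ∀ x, 0 ≤ f x) (hfm : Measurable f)
    (hf : Integrable f) (hf1 : ∫ x, f x = 1) (hφ0 : ∀ x, 0 ≤ φ x) (hφm : Measurable φ)
    (hφ : Integrable φ) (hφ_one : ∫ x, φ x = 1) (hφ1 : Integrable fun u => ‖u‖ * φ u)
    (hwm : Measurable w) {C : ℝ} (hw : ∀ x z, |w (x + z) - w x| ≤ C * ‖z‖)
    (hfw : Integrable fun x => f x * w x) (s : ℝ) :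
    |(∫ x, addScaledDensity f φ s x * w x) - ∫ x, f x * w x| ≤ C * |s| * ∫ u, ‖u‖ * φ u := by
  have hF := integrable_smoothing_prod hf0 hfm hf hφ0 hφm hφ hφ1 hwm hw hfw s
  have e : ∫ x, addScaledDensity f φ s x * w x = ∫ u, ∫ x, f (x - s • u) * φ u * w x := by
    rw [← integral_integral_swap (f := fun x u => f (x - s • u) * φ u * w x) hF]
    simp only [addScaledDensity, integral_mul_const]
  have e2 : ∫ x, f x * w x = ∫ u, φ u * ∫ x, f x * w x := by
    rw [integral_mul_const, hφ_one, one_mul]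
  have hb : Integrable fun u => C * |s| * (‖u‖ * φ u) := hφ1.const_mul _
  rw [e, e2, ← integral_sub hF.integral_prod_right (hφ.mul_const _), ← integral_const_mul,
    ← Real.norm_eq_abs]
  refine norm_integral_le_of_norm_le hb (.of_forall fun u => ?_)
  have e3 : ∫ x, f (x - s • u) * φ u * w x = φ u * ∫ x, f x * w (x + s • u) := by
    rw [← integral_const_mul,
      ← integral_sub_right_eq_self (fun x => φ u * (f x * w (x + s • u))) (s • u)]
    congr 1
    ext x
    simp only [sub_add_cancel]
    ring
  have hi := integrable_mul_comp_add hf0 hfm hf hwm hw hfw (s • u)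
  rw [e3, ← mul_sub, norm_mul, Real.norm_of_nonneg (hφ0 u), ← integral_sub hi hfw]
  have : ‖∫ x, (f x * w (x + s • u) - f x * w x)‖ ≤ ∫ x, f x * (C * (|s| * ‖u‖)) := by
    refine norm_integral_le_of_norm_le (hf.mul_const _) (.of_forall fun x => ?_)
    rw [← mul_sub, norm_mul, Real.norm_of_nonneg (hf0 x)]
    have := hw x (s • u)
    rw [norm_smul, Real.norm_eq_abs] at this
    exact mul_le_mul_of_nonneg_left this (hf0 x)
  rw [integral_mul_const, hf1, one_mul] at this
  calc _ ≤ φ u * (C * (|s| * ‖u‖)) := mul_le_mul_of_nonneg_left this (hφ0 u)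
    _ = _ := by ring

theorem tendsto_integral_abs_comp_sub_sub (hf : Integrable f) :
    Tendsto (fun y => ∫ x, |f (x - y) - f x|) (𝓝 0) (𝓝 0) := by
  have hp := memLp_one_iff_integrable.2 hf
  let g : C(Fin d → ℝ, C(Fin d → ℝ, Fin d → ℝ)) :=
    (ContinuousMap.mk (fun p : (Fin d → ℝ) × (Fin d → ℝ) => p.2 - p.1) (by fun_prop)).curry
  have hgm (y : Fin d → ℝ) : MeasurePreserving (g y) volume volume :=
    measurePreserving_sub_right volume y
  have hc : Continuous fun y => ‖Lp.compMeasurePreserving (g y) (hgm y) (hp.toLp f) -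
      Lp.compMeasurePreserving (g 0) (hgm 0) (hp.toLp f)‖ :=
    ((continuous_const.compMeasurePreservingLp g.continuous hgm ENNReal.one_ne_top).sub
      continuous_const).norm
  have h0 := hc.tendsto 0
  rw [sub_self, norm_zero] at h0
  refine h0.congr fun y => ?_
  rw [Lp.toLp_compMeasurePreserving hp, Lp.toLp_compMeasurePreserving hp, ← MemLp.toLp_sub,
    Lp.norm_toLp, eLpNorm_one_eq_lintegral_enorm, ← integral_norm_eq_lintegral_enorm]
  · simp [g]
  · exact ((hp.comp_measurePreserving (hgm y)).sub (hp.comp_measurePreserving (hgm 0))).1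

theorem integrable_addScaledDensity (hf0 : ∀ x, 0 ≤ f x) (hfm : Measurable f)
    (hf : Integrable f) (hφ0 : ∀ x, 0 ≤ φ x) (hφm : Measurable φ) (hφ : Integrable φ)
    (hφ1 : Integrable fun u => ‖u‖ * φ u) (s : ℝ) :
    Integrable (addScaledDensity f φ s) := by
  simpa using integrable_addScaledDensity_mul hf0 hfm hf hφ0 hφm hφ hφ1 (w := fun _ => 1)
    measurable_const (C := 0) (by simp) (by simpa using hf) s

theorem integral_addScaledDensity (hf0 : ∀ x, 0 ≤ f x) (hfm : Measurable f)
    (hf : Integrable f) (hf1 : ∫ x, f x = 1) (hφ0 : ∀ x, 0 ≤ φ x) (hφm : Measurable φ)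
    (hφ : Integrable φ) (hφ_one : ∫ x, φ x = 1) (hφ1 : Integrable fun u => ‖u‖ * φ u) (s : ℝ) :
    ∫ x, addScaledDensity f φ s x = 1 := by
  have h := abs_integral_addScaledDensity_mul_sub_le hf0 hfm hf hf1 hφ0 hφm hφ hφ_one hφ1
    (w := fun _ => 1) measurable_const (C := 0) (by simp) (by simpa using hf) s
  simp only [mul_one, hf1, zero_mul] at h
  linarith [abs_nonpos_iff.1 h]

theorem tendsto_eLpNorm_addScaledDensity_sub (hf0 : ∀ x, 0 ≤ f x) (hfm : Measurable f)
    (hf : Integrable f) (hφ0 : ∀ x, 0 ≤ φ x) (hφm : Measurable φ)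
    (hφ : Integrable φ) (hφ_one : ∫ x, φ x = 1) (hφ1 : Integrable fun u => ‖u‖ * φ u) :
    Tendsto (fun s => eLpNorm (addScaledDensity f φ s - f) 1 volume) (𝓝 0) (𝓝 0) := by
  have hg (s : ℝ) := integrable_addScaledDensity hf0 hfm hf hφ0 hφm hφ hφ1 s
  have hprod (s : ℝ) : Integrable (fun p : (Fin d → ℝ) × (Fin d → ℝ) =>
      |f (p.1 - s • p.2) - f p.1| * φ p.2) (volume.prod volume) := by
    have h := integrable_smoothing_prod hf0 hfm hf hφ0 hφm hφ hφ1 (w := fun _ => 1)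
      measurable_const (C := 0) (by simp) (by simpa using hf) s
    refine (h.sub (hf.mul_prod hφ)).abs.congr (.of_forall fun p => ?_)
    simp only [Pi.sub_apply, mul_one]
    rw [← sub_mul, abs_mul, abs_of_nonneg (hφ0 p.2)]
  have hle (s : ℝ) : ∫ x, |addScaledDensity f φ s x - f x| ≤
      ∫ u, (∫ x, |f (x - s • u) - f x|) * φ u := by
    have hsw : ∫ u, (∫ x, |f (x - s • u) - f x|) * φ u =
        ∫ x, ∫ u, |f (x - s • u) - f x| * φ u := by
      rw [integral_integral_swap (f := fun x u => |f (x - s • u) - f x| * φ u) (hprod s)]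
      simp only [integral_mul_const]
    rw [hsw]
    have hae := (integrable_smoothing_prod hf0 hfm hf hφ0 hφm hφ hφ1 (w := fun _ => 1)
      measurable_const (C := 0) (by simp) (by simpa using hf) s).prod_right_ae
    refine integral_mono_ae ((hg s).sub hf).abs (hprod s).integral_prod_left ?_
    filter_upwards [hae] with x hx
    simp only [mul_one] at hx
    have e : addScaledDensity f φ s x - f x = ∫ u, (f (x - s • u) * φ u - f x * φ u) := by
      rw [integral_sub hx (hφ.const_mul _), integral_const_mul, hφ_one, mul_one]
      rfl
    rw [e]
    refine (abs_integral_le_integral_abs).trans (integral_mono_of_nonneg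
      (.of_forall fun _ => abs_nonneg _) ?_ (.of_forall fun u => ?_))
    · refine (hx.sub (hφ.const_mul (f x))).abs.congr (.of_forall fun u => ?_)
      simp only [Pi.sub_apply]
      rw [← sub_mul, abs_mul, abs_of_nonneg (hφ0 u)]
    · simp only
      rw [← sub_mul, abs_mul, abs_of_nonneg (hφ0 u)]
  have hT2 (y : Fin d → ℝ) : ∫ x, |f (x - y) - f x| ≤ 2 * ∫ x, f x := by
    calc ∫ x, |f (x - y) - f x| ≤ ∫ x, (f (x - y) + f x) :=
          integral_mono ((hf.comp_sub_right y).sub hf).abs ((hf.comp_sub_right y).add hf)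
            fun x => (abs_sub _ _).trans_eq (by rw [abs_of_nonneg (hf0 _), abs_of_nonneg (hf0 _)])
      _ = _ := by rw [integral_add (hf.comp_sub_right y) hf, integral_sub_right_eq_self]; ring
  have hlim : Tendsto (fun s : ℝ => ∫ u, (∫ x, |f (x - s • u) - f x|) * φ u) (𝓝 0) (𝓝 0) := by
    have h0 : (0 : ℝ) = ∫ u : Fin d → ℝ, (0 : ℝ) * φ u := by simp
    nth_rw 2 [h0]
    refine tendsto_integral_filter_of_dominated_convergence
      (fun u => (2 * ∫ x, f x) * φ u) (.of_forall fun s => ?_)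
      (.of_forall fun s => .of_forall fun u => ?_) (hφ.const_mul _) (.of_forall fun u => ?_)
    · have := (hprod s).integral_prod_right.1
      simpa only [integral_mul_const] using this
    · rw [norm_mul, Real.norm_of_nonneg (hφ0 u),
        Real.norm_of_nonneg (integral_nonneg fun _ => abs_nonneg _)]
      exact mul_le_mul_of_nonneg_right (hT2 _) (hφ0 u)
    · refine Tendsto.mul_const _ ((tendsto_integral_abs_comp_sub_sub hf).comp ?_)
      have : Continuous fun s : ℝ => s • u := by fun_prop
      simpa using this.tendsto 0
  have hreal : Tendsto (fun s => ∫ x, |addScaledDensity f φ s x - f x|) (𝓝 0) (𝓝 0) :=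
    squeeze_zero (fun s => integral_nonneg fun _ => abs_nonneg _) hle hlim
  have := ENNReal.tendsto_ofReal hreal
  rw [ENNReal.ofReal_zero] at this
  refine this.congr fun s => ?_
  rw [eLpNorm_one_eq_lintegral_enorm, ← ofReal_integral_norm_eq_lintegral_enorm ((hg s).sub hf)]
  rfl

end Smoothing

section Semicontinuity

variable {d : ℕ} {f φ q : (Fin d → ℝ) → ℝ}

theorem integrable_mul_log_of_le {g : (Fin d → ℝ) → ℝ} (hg0 : ∀ x, 0 ≤ g x) (hgm : Measurable g)
    (hg : Integrable g) {B : ℝ} (hgB : ∀ x, g x ≤ B) (hq0 : ∀ x, 0 < q x) (hq : Integrable q)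
    (hgq : Integrable fun x => g x * Real.log (q x)) :
    Integrable fun x => g x * Real.log (g x) := by
  refine (((hgq.abs.add hg).add hq).add (hg.mul_const |Real.log B|)).mono'
    (hgm.mul hgm.log).aestronglyMeasurable (.of_forall fun x => ?_)
  simp only [Pi.add_apply, Real.norm_eq_abs]
  have hup : g x * Real.log (g x) ≤ g x * |Real.log B| := by
    rcases (hg0 x).eq_or_lt with h | h
    · simp [← h]
    · exact mul_le_mul_of_nonneg_left ((Real.log_le_log h (hgB x)).trans (le_abs_self _)) (hg0 x)
  have hlow := mul_log_sub_mul_log_sub_add_nonneg (hg0 x) (hq0 x)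
  have h1 := neg_abs_le (g x * Real.log (q x))
  have h2 := abs_nonneg (g x * Real.log (q x))
  have h3 := mul_nonneg (hg0 x) (abs_nonneg (Real.log B))
  have h4 := hg0 x
  have h5 := (hq0 x).le
  exact abs_le.2 ⟨by linarith, by linarith⟩

theorem eventually_entropy_addScaledDensity_lt (hf0 : ∀ x, 0 ≤ f x) (hfm : Measurable f)
    (hf : Integrable f) (hf1 : ∫ x, f x = 1)
    (hent : Integrable fun x => f x * Real.log (f x))
    (hφ0 : ∀ x, 0 ≤ φ x) (hφm : Measurable φ) (hφ : Integrable φ) (hφ_one : ∫ x, φ x = 1)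
    (hφ1 : Integrable fun u => ‖u‖ * φ u) {M : ℝ} (hφM : ∀ x, φ x ≤ M)
    (hq0 : ∀ x, 0 < q x) (hqm : Measurable q) (hq : Integrable q) {C : ℝ}
    (hqlip : ∀ x z, |Real.log (q (x + z)) - Real.log (q x)| ≤ C * ‖z‖)
    (hfq : Integrable fun x => f x * Real.log (q x)) {b : ℝ}
    (hb : -∫ x, f x * Real.log (f x) < b) :
    ∀ᶠ s in 𝓝[>] (0 : ℝ),
      -∫ x, addScaledDensity f φ s x * Real.log (addScaledDensity f φ s x) < b := by
  by_contra hcon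
  have hfreq : ∃ᶠ s in 𝓝[>] (0 : ℝ), 0 < s ∧
      b ≤ -∫ x, addScaledDensity f φ s x * Real.log (addScaledDensity f φ s x) := by
    rw [not_eventually] at hcon
    exact (hcon.and_eventually self_mem_nhdsWithin).mono fun s hs => ⟨hs.2, not_lt.1 hs.1⟩
  obtain ⟨t, ht, htb⟩ := exists_seq_forall_of_frequently hfreq
  have ht0 : Tendsto t atTop (𝓝 0) := ht.mono_right nhdsWithin_le_nhds
  have hgm (s : ℝ) := measurable_addScaledDensity hfm hφm s
  have hg (s : ℝ) := integrable_addScaledDensity hf0 hfm hf hφ0 hφm hφ hφ1 s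
  have hg0 (s : ℝ) := addScaledDensity_nonneg hf0 hφ0 s
  obtain ⟨ns, hns, hae⟩ := (tendstoInMeasure_of_tendsto_eLpNorm one_ne_zero
    (fun n => (hgm (t n)).aestronglyMeasurable) hfm.aestronglyMeasurable
    ((tendsto_eLpNorm_addScaledDensity_sub hf0 hfm hf hφ0 hφm hφ hφ_one hφ1).comp
      ht0)).exists_seq_tendsto_ae'
  have hgq (s : ℝ) := integrable_addScaledDensity_mul hf0 hfm hf hφ0 hφm hφ hφ1 hqm.log hqlip hfq s
  have hglog {s : ℝ} (hs : 0 < s) := integrable_mul_log_of_le (hg0 s) (hgm s) (hg s)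
    (addScaledDensity_le hf0 hf hφ0 hφM hs.ne') hq0 hq (hgq s)
  -- the integrand of the relative entropy with respect to `q`
  let Φ (g : (Fin d → ℝ) → ℝ) (x : Fin d → ℝ) : ℝ :=
    g x * Real.log (g x) - g x * Real.log (q x) - g x + q x
  have hΦ0 {g : (Fin d → ℝ) → ℝ} (hg0 : ∀ x, 0 ≤ g x) (x : Fin d → ℝ) : 0 ≤ Φ g x :=
    mul_log_sub_mul_log_sub_add_nonneg (hg0 x) (hq0 x)
  have hΦi {g : (Fin d → ℝ) → ℝ} (h1 : Integrable fun x => g x * Real.log (g x))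
      (h2 : Integrable fun x => g x * Real.log (q x)) (h3 : Integrable g) :
      Integrable (Φ g) ∧ ∫ x, Φ g x = (∫ x, g x * Real.log (g x)) -
        (∫ x, g x * Real.log (q x)) - (∫ x, g x) + ∫ x, q x := by
    refine ⟨((h1.sub h2).sub h3).add hq, ?_⟩
    have e1 := integral_add ((h1.sub h2).sub h3) hq
    have e2 := integral_sub (h1.sub h2) h3
    have e3 := integral_sub h1 h2
    simp only [Pi.sub_apply] at e1 e2 e3
    rw [← e3, ← e2, ← e1]
  obtain ⟨hΦf, hΦf_eq⟩ := hΦi hent hfq hf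
  have hΦg (n : ℕ) := hΦi (hglog (htb (ns n)).1) (hgq (t (ns n))) (hg (t (ns n)))
  have hΦm {g : (Fin d → ℝ) → ℝ} (h : Measurable g) : Measurable (Φ g) :=
    (((h.mul h.log).sub (h.mul hqm.log)).sub h).add hqm
  have hgqlim : Tendsto (fun n => ∫ x, addScaledDensity f φ (t (ns n)) x * Real.log (q x)) atTop
      (𝓝 (∫ x, f x * Real.log (q x))) := by
    rw [tendsto_iff_norm_sub_tendsto_zero]
    refine squeeze_zero (fun _ => norm_nonneg _) (fun n =>
      abs_integral_addScaledDensity_mul_sub_le hf0 hfm hf hf1 hφ0 hφm hφ hφ_one hφ1 hqm.log hqlip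
        hfq (t (ns n))) ?_
    have := (((ht0.comp hns).abs.const_mul C).mul_const (∫ u, ‖u‖ * φ u))
    simpa using this
  have hFatou : ENNReal.ofReal (∫ x, Φ f x) ≤
      liminf (fun n => ENNReal.ofReal (∫ x, Φ (addScaledDensity f φ (t (ns n))) x)) atTop := by
    simp only [ofReal_integral_eq_lintegral_ofReal hΦf (.of_forall (hΦ0 hf0)),
      fun n => ofReal_integral_eq_lintegral_ofReal (hΦg n).1 (.of_forall (hΦ0 (hg0 _)))]
    refine le_trans (lintegral_mono_ae ?_)
      (lintegral_liminf_le fun n => (hΦm (hgm (t (ns n)))).ennreal_ofReal)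
    filter_upwards [hae] with x hx
    refine (ENNReal.tendsto_ofReal ?_).liminf_eq.ge
    exact ((((Real.continuous_mul_log.tendsto (f x)).comp hx).sub (hx.mul_const _)).sub
      hx).add_const _
  have hup : liminf (fun n => ENNReal.ofReal (∫ x, Φ (addScaledDensity f φ (t (ns n))) x)) atTop ≤
      ENNReal.ofReal (-b - (∫ x, f x * Real.log (q x)) - 1 + ∫ x, q x) := by
    have hlim : Tendsto (fun n => ENNReal.ofReal
        (-b - (∫ x, addScaledDensity f φ (t (ns n)) x * Real.log (q x)) - 1 + ∫ x, q x)) atTop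
        (𝓝 (ENNReal.ofReal (-b - (∫ x, f x * Real.log (q x)) - 1 + ∫ x, q x))) :=
      ENNReal.tendsto_ofReal (((hgqlim.const_sub _).sub_const _).add_const _)
    rw [← hlim.liminf_eq]
    refine liminf_le_liminf (.of_forall fun n => ENNReal.ofReal_le_ofReal ?_)
    rw [(hΦg n).2, integral_addScaledDensity hf0 hfm hf hf1 hφ0 hφm hφ hφ_one hφ1]
    linarith [(htb (ns n)).2]
  have hfin := hFatou.trans hup
  have hpos : 0 ≤ -b - (∫ x, f x * Real.log (q x)) - 1 + ∫ x, q x := by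
    refine ge_of_tendsto' (((hgqlim.const_sub _).sub_const _).add_const _) fun n => ?_
    have h1 : 0 ≤ ∫ x, Φ (addScaledDensity f φ (t (ns n))) x := integral_nonneg (hΦ0 (hg0 _))
    rw [(hΦg n).2, integral_addScaledDensity hf0 hfm hf hf1 hφ0 hφm hφ hφ_one hφ1] at h1
    linarith [(htb (ns n)).2]
  rw [ENNReal.ofReal_le_ofReal_iff hpos, hΦf_eq, hf1] at hfin
  linarith

end Semicontinuity

section Seminorm

variable {d : ℕ} {ν : Seminorm ℝ (Fin d → ℝ)}

theorem Seminorm.exists_norm_le_mul (hνdef : ∀ x, ν x = 0 → x = 0)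
    (hνcont : Continuous fun x => ν x) : ∃ K : ℝ, 0 < K ∧ ∀ x, ‖x‖ ≤ K * ν x := by
  rcases (Metric.sphere (0 : Fin d → ℝ) 1).eq_empty_or_nonempty with he | hne
  · refine ⟨1, one_pos, fun x => ?_⟩
    rcases eq_or_ne x 0 with rfl | hx
    · simp
    · have : ‖x‖⁻¹ • x ∈ Metric.sphere (0 : Fin d → ℝ) 1 := by
        simp [norm_smul, inv_mul_cancel₀ (norm_ne_zero_iff.2 hx)]
      simp [he] at this
  · obtain ⟨x₀, hx₀, hmin⟩ := (isCompact_sphere (0 : Fin d → ℝ) 1).exists_isMinOn hne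
      hνcont.continuousOn
    have hpos : 0 < ν x₀ := by
      refine (apply_nonneg ν x₀).lt_of_ne' fun h => ?_
      simp [hνdef x₀ h] at hx₀
    refine ⟨(ν x₀)⁻¹, inv_pos.2 hpos, fun x => ?_⟩
    rcases eq_or_ne x 0 with rfl | hx
    · simp
    · have hx' := norm_pos_iff.2 hx
      have hmem : ‖x‖⁻¹ • x ∈ Metric.sphere (0 : Fin d → ℝ) 1 := by
        simp [norm_smul, inv_mul_cancel₀ hx'.ne']
      have h : ν x₀ ≤ ν (‖x‖⁻¹ • x) := hmin hmem
      rw [map_smul_eq_mul, norm_inv, norm_norm, ← div_eq_inv_mul, le_div_iff₀ hx'] at h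
      rw [← div_eq_inv_mul, le_div_iff₀ hpos]
      linarith

theorem Seminorm.measure_lt_one_eq (hνdef : ∀ x, ν x = 0 → x = 0) {r : ℝ} (hr : 0 < r) :
    volume {x | ν x < 1} =
      ENNReal.ofReal ((∫ x, Real.exp (-ν x ^ r)) / Real.Gamma (d / r + 1)) := by
  have := measure_lt_one_eq_integral_div_gamma (volume : Measure (Fin d → ℝ)) (g := ν)
    (map_zero ν) (map_neg_eq_map ν) (map_add_le_add ν) (fun {x} => hνdef x)
    (fun r x => (map_smul_eq_mul ν r x).le) hr
  simpa using this

theorem Seminorm.measure_lt_one_pos (hνcont : Continuous fun x => ν x) :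
    0 < volume {x | ν x < 1} :=
  (isOpen_lt hνcont continuous_const).measure_pos volume ⟨0, by simp⟩

theorem Seminorm.integral_exp_neg_rpow_pos (hνdef : ∀ x, ν x = 0 → x = 0)
    (hνcont : Continuous fun x => ν x) {r : ℝ} (hr : 0 < r) :
    0 < ∫ x, Real.exp (-ν x ^ r) := by
  have h := Seminorm.measure_lt_one_pos hνcont
  rw [Seminorm.measure_lt_one_eq hνdef hr, ENNReal.ofReal_pos] at h
  exact (div_pos_iff_of_pos_right (Real.Gamma_pos_of_pos (by positivity))).1 h

theorem Seminorm.integral_exp_neg_rpow (hd : 1 ≤ d) (hνdef : ∀ x, ν x = 0 → x = 0)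
    (hνcont : Continuous fun x => ν x) {r : ℝ} (hr : 0 < r) :
    ∫ x, Real.exp (-ν x ^ r) =
      (volume {x | ν x ≤ 1}).toReal * Real.Gamma (d / r + 1) := by
  have : Nonempty (Fin d) := ⟨⟨0, hd⟩⟩
  have hG : 0 < Real.Gamma (d / r + 1) := Real.Gamma_pos_of_pos (by positivity)
  have hle := measure_le_eq_lt (volume : Measure (Fin d → ℝ)) (g := ν)
    (map_zero ν) (map_neg_eq_map ν) (map_add_le_add ν) (fun {x} => hνdef x)
    (fun r x => (map_smul_eq_mul ν r x).le) 1
  rw [hle, Seminorm.measure_lt_one_eq hνdef hr, ENNReal.toReal_ofReal, div_mul_cancel₀ _ hG.ne']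
  exact div_nonneg (Seminorm.integral_exp_neg_rpow_pos hνdef hνcont hr).le hG.le

theorem Seminorm.volume_le_one_pos (hd : 1 ≤ d) (hνdef : ∀ x, ν x = 0 → x = 0)
    (hνcont : Continuous fun x => ν x) : 0 < (volume {x | ν x ≤ 1}).toReal := by
  have h := Seminorm.integral_exp_neg_rpow_pos hνdef hνcont one_pos
  rw [Seminorm.integral_exp_neg_rpow hd hνdef hνcont one_pos] at h
  exact (pos_iff_pos_of_mul_pos h).2 (Real.Gamma_pos_of_pos (by positivity))

theorem Seminorm.exp_neg_mul_rpow_eq {r c : ℝ} (hr : 0 < r) (hc : 0 < c) (x : Fin d → ℝ) :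
    Real.exp (-c * ν x ^ r) = Real.exp (-ν (c ^ (1 / r) • x) ^ r) := by
  have hc' : 0 ≤ c ^ (1 / r) := by positivity
  rw [map_smul_eq_mul, Real.norm_of_nonneg hc', Real.mul_rpow hc' (apply_nonneg ν x),
    ← Real.rpow_mul hc.le, one_div_mul_cancel hr.ne', Real.rpow_one, neg_mul]

theorem Seminorm.integrable_exp_neg_mul_rpow (hνdef : ∀ x, ν x = 0 → x = 0)
    (hνcont : Continuous fun x => ν x) {r c : ℝ} (hr : 0 < r) (hc : 0 < c) :
    Integrable fun x => Real.exp (-c * ν x ^ r) := by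
  simp only [Seminorm.exp_neg_mul_rpow_eq hr hc]
  refine (integrable_comp_smul_iff volume (fun x => Real.exp (-ν x ^ r))
    (Real.rpow_pos_of_pos hc _).ne').2 ?_
  by_contra h
  exact (Seminorm.integral_exp_neg_rpow_pos hνdef hνcont hr).ne' (integral_undef h)

theorem Seminorm.integral_exp_neg_mul_rpow (hd : 1 ≤ d) (hνdef : ∀ x, ν x = 0 → x = 0)
    (hνcont : Continuous fun x => ν x) {r c : ℝ} (hr : 0 < r) (hc : 0 < c) :
    ∫ x, Real.exp (-c * ν x ^ r) =
      (c ^ (d / r))⁻¹ * ((volume {x | ν x ≤ 1}).toReal * Real.Gamma (d / r + 1)) := by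
  simp only [Seminorm.exp_neg_mul_rpow_eq hr hc]
  rw [Measure.integral_comp_smul volume (fun x => Real.exp (-ν x ^ r)),
    Seminorm.integral_exp_neg_rpow hd hνdef hνcont hr, smul_eq_mul, abs_of_nonneg (by positivity),
    Module.finrank_fin_fun, ← Real.rpow_natCast, ← Real.rpow_mul hc.le]
  congr 3
  ring

theorem Seminorm.integrable_norm_mul_exp_neg_mul_rpow (hνdef : ∀ x, ν x = 0 → x = 0)
    (hνcont : Continuous fun x => ν x) {r c : ℝ} (hr : 0 < r) (hc : 0 < c) :
    Integrable fun x => ‖x‖ * Real.exp (-c * ν x ^ r) := by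
  obtain ⟨K, hK, hKν⟩ := Seminorm.exists_norm_le_mul hνdef hνcont
  have hmeas : Measurable fun x => ν x := hνcont.measurable
  refine ((Seminorm.integrable_exp_neg_mul_rpow hνdef hνcont hr (half_pos hc)).const_mul
    (K * ((c / 2 * r)⁻¹) ^ (1 / r))).mono' (by fun_prop) (.of_forall fun x => ?_)
  have ht := apply_nonneg ν x
  have hbound : ν x ≤ ((c / 2 * r)⁻¹) ^ (1 / r) * Real.exp (c / 2 * ν x ^ r) := by
    have h1 : c / 2 * r * ν x ^ r ≤ Real.exp (c / 2 * r * ν x ^ r) := by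
      linarith [Real.add_one_le_exp (c / 2 * r * ν x ^ r)]
    have h2 : ν x ^ r ≤ (c / 2 * r)⁻¹ * Real.exp (c / 2 * r * ν x ^ r) := by
      rw [← div_eq_inv_mul, le_div_iff₀ (by positivity)]
      linarith
    have h3 := Real.rpow_le_rpow (by positivity) h2 (by positivity : 0 ≤ 1 / r)
    rw [← Real.rpow_mul ht, mul_one_div_cancel hr.ne', Real.rpow_one,
      Real.mul_rpow (by positivity) (Real.exp_pos _).le, ← Real.exp_mul] at h3
    convert h3 using 3
    field_simp
  rw [norm_mul, norm_norm, Real.norm_of_nonneg (Real.exp_pos _).le]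
  calc ‖x‖ * Real.exp (-c * ν x ^ r)
      ≤ K * (((c / 2 * r)⁻¹) ^ (1 / r) * Real.exp (c / 2 * ν x ^ r)) *
          Real.exp (-c * ν x ^ r) := by
        gcongr
        exact (hKν x).trans (by gcongr)
    _ = K * ((c / 2 * r)⁻¹) ^ (1 / r) *
          (Real.exp (c / 2 * ν x ^ r) * Real.exp (-c * ν x ^ r)) := by ring
    _ = _ := by rw [← Real.exp_add]; congr 2; ring

end Seminorm

section ReferenceDensity

variable {d : ℕ} {f : (Fin d → ℝ) → ℝ}

/-- The density of `X + L` where `X` has density `f` and `L` is independent of `X` with density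
proportional to `exp (-‖·‖)`, up to normalization. -/
noncomputable def laplaceSmoothing (f : (Fin d → ℝ) → ℝ) : (Fin d → ℝ) → ℝ :=
  addScaledDensity f (fun u => Real.exp (-‖u‖)) 1

theorem laplaceSmoothing_eq (f : (Fin d → ℝ) → ℝ) (x : Fin d → ℝ) :
    laplaceSmoothing f x = ∫ y, f y * Real.exp (-‖x - y‖) := by
  rw [laplaceSmoothing, addScaledDensity,
    ← integral_sub_left_eq_self (fun y => f y * Real.exp (-‖x - y‖)) volume x]
  simp

theorem measurable_laplaceSmoothing (hfm : Measurable f) : Measurable (laplaceSmoothing f) :=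
  measurable_addScaledDensity hfm (by fun_prop) 1

theorem integrable_laplaceSmoothing (hf0 : ∀ x, 0 ≤ f x) (hfm : Measurable f)
    (hf : Integrable f) : Integrable (laplaceSmoothing f) := by
  have hdef (x : Fin d → ℝ) (hx : normSeminorm ℝ (Fin d → ℝ) x = 0) : x = 0 := by simpa using hx
  have hcont : Continuous fun x => normSeminorm ℝ (Fin d → ℝ) x := by simpa using continuous_norm
  have h1 := Seminorm.integrable_exp_neg_mul_rpow hdef hcont one_pos one_pos
  have h2 := Seminorm.integrable_norm_mul_exp_neg_mul_rpow hdef hcont one_pos one_pos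
  simp only [coe_normSeminorm, Real.rpow_one, neg_mul, one_mul] at h1 h2
  exact integrable_addScaledDensity hf0 hfm hf (fun _ => (Real.exp_pos _).le) (by fun_prop) h1 h2 1

theorem integrable_mul_exp_neg_norm_sub (hfm : Measurable f) (hf : Integrable f)
    (x : Fin d → ℝ) : Integrable fun y => f y * Real.exp (-‖x - y‖) :=
  hf.norm.mono' (by fun_prop) (.of_forall fun y => by
    rw [norm_mul, Real.norm_of_nonneg (Real.exp_pos _).le]
    exact mul_le_of_le_one_right (norm_nonneg _) (Real.exp_le_one_iff.2 (by simp)))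

theorem laplaceSmoothing_pos (hf0 : ∀ x, 0 ≤ f x) (hfm : Measurable f)
    (hf : Integrable f) (hf1 : ∫ x, f x = 1) (x : Fin d → ℝ) : 0 < laplaceSmoothing f x := by
  rw [laplaceSmoothing_eq, integral_pos_iff_support_of_nonneg
    (fun y => mul_nonneg (hf0 y) (Real.exp_pos _).le) (integrable_mul_exp_neg_norm_sub hfm hf x)]
  have : Function.support (fun y => f y * Real.exp (-‖x - y‖)) = Function.support f := by
    ext y
    simp [(Real.exp_pos _).ne']
  rw [this, ← integral_pos_iff_support_of_nonneg hf0 hf, hf1]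
  exact one_pos

theorem laplaceSmoothing_le_one (hf0 : ∀ x, 0 ≤ f x) (hf : Integrable f) (hf1 : ∫ x, f x = 1)
    (x : Fin d → ℝ) : laplaceSmoothing f x ≤ 1 := by
  rw [laplaceSmoothing_eq, ← hf1]
  exact integral_mono_of_nonneg (.of_forall fun y => mul_nonneg (hf0 y) (Real.exp_pos _).le) hf
    (.of_forall fun y => mul_le_of_le_one_right (hf0 y) (Real.exp_le_one_iff.2 (by simp)))

theorem laplaceSmoothing_add_le (hf0 : ∀ x, 0 ≤ f x) (hfm : Measurable f)
    (hf : Integrable f) (x z : Fin d → ℝ) :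
    laplaceSmoothing f (x + z) ≤ Real.exp ‖z‖ * laplaceSmoothing f x := by
  rw [laplaceSmoothing_eq, laplaceSmoothing_eq, ← integral_const_mul]
  refine integral_mono (integrable_mul_exp_neg_norm_sub hfm hf _)
    ((integrable_mul_exp_neg_norm_sub hfm hf x).const_mul _) fun y => ?_
  have h : ‖x - y‖ ≤ ‖x + z - y‖ + ‖z‖ := by
    calc ‖x - y‖ = ‖(x + z - y) - z‖ := by congr 1; abel
      _ ≤ _ := norm_sub_le _ _
  have : Real.exp (-‖x + z - y‖) ≤ Real.exp ‖z‖ * Real.exp (-‖x - y‖) := by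
    rw [← Real.exp_add]
    exact Real.exp_le_exp.2 (by linarith)
  calc f y * Real.exp (-‖x + z - y‖) ≤ f y * (Real.exp ‖z‖ * Real.exp (-‖x - y‖)) :=
        mul_le_mul_of_nonneg_left this (hf0 y)
    _ = _ := by ring

theorem abs_log_laplaceSmoothing_add_sub_le (hf0 : ∀ x, 0 ≤ f x) (hfm : Measurable f)
    (hf : Integrable f) (hf1 : ∫ x, f x = 1) (x z : Fin d → ℝ) :
    |Real.log (laplaceSmoothing f (x + z)) - Real.log (laplaceSmoothing f x)| ≤ 1 * ‖z‖ := by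
  have key (x z : Fin d → ℝ) :
      Real.log (laplaceSmoothing f (x + z)) ≤ ‖z‖ + Real.log (laplaceSmoothing f x) := by
    have h := Real.log_le_log (laplaceSmoothing_pos hf0 hfm hf hf1 (x + z))
      (laplaceSmoothing_add_le hf0 hfm hf x z)
    rwa [Real.log_mul (Real.exp_pos _).ne' (laplaceSmoothing_pos hf0 hfm hf hf1 x).ne',
      Real.log_exp] at h
  have h1 := key x z
  have h2 := key (x + z) (-z)
  rw [add_neg_cancel_right, norm_neg] at h2
  exact abs_le.2 ⟨by linarith, by linarith⟩

theorem measurable_intFloor (d : ℕ) : Measurable (intFloor d) :=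
  measurable_pi_lambda _ fun i => Int.measurable_floor.comp (measurable_pi_apply i)

theorem norm_sub_le_one_of_intFloor_eq {x y : Fin d → ℝ} (h : intFloor d y = intFloor d x) :
    ‖x - y‖ ≤ 1 :=
  (pi_norm_le_iff_of_nonneg zero_le_one).2 fun i =>
    (Int.abs_sub_lt_one_of_floor_eq_floor (congrFun h i).symm).le

theorem toReal_withDensity_intFloor_preimage (hf0 : ∀ x, 0 ≤ f x) (hf : Integrable f)
    (i : Fin d → ℤ) :
    ((volume.withDensity fun x => ENNReal.ofReal (f x)) (intFloor d ⁻¹' {i})).toReal =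
      ∫ y in intFloor d ⁻¹' {i}, f y := by
  rw [withDensity_apply _ (measurable_intFloor d (measurableSet_singleton i)),
    ← ofReal_integral_eq_lintegral_ofReal hf.integrableOn (.of_forall hf0),
    ENNReal.toReal_ofReal (integral_nonneg hf0)]

theorem exp_neg_one_mul_le_laplaceSmoothing (hf0 : ∀ x, 0 ≤ f x) (hfm : Measurable f)
    (hf : Integrable f) (x : Fin d → ℝ) :
    Real.exp (-1) * ∫ y in intFloor d ⁻¹' {intFloor d x}, f y ≤ laplaceSmoothing f x := by
  have hi := integrable_mul_exp_neg_norm_sub hfm hf x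
  rw [laplaceSmoothing_eq, ← integral_const_mul]
  refine le_trans (setIntegral_mono_on (hf.const_mul _).integrableOn hi.integrableOn
    (measurable_intFloor d (measurableSet_singleton _)) fun y hy => ?_)
    (setIntegral_le_integral hi (.of_forall fun y => mul_nonneg (hf0 y) (Real.exp_pos _).le))
  rw [mul_comm]
  have h1 := norm_sub_le_one_of_intFloor_eq hy
  exact mul_le_mul_of_nonneg_left (Real.exp_le_exp.2 (by linarith)) (hf0 y)

theorem lintegral_neg_log_measure_eq_discEnt {Ω α : Type*} [MeasurableSpace Ω]
    [MeasurableSpace α] [Countable α] [MeasurableSingletonClass α] (P : Measure Ω)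
    [IsFiniteMeasure P] {V : Ω → α} (hV : Measurable V) :
    ∫⁻ ω, ENNReal.ofReal (-Real.log (P (V ⁻¹' {V ω})).toReal) ∂P = discEnt P V := by
  rw [← lintegral_map (f := fun a => ENNReal.ofReal (-Real.log (P (V ⁻¹' {a})).toReal))
    (measurable_of_countable _) hV, lintegral_countable', discEnt]
  refine tsum_congr fun a => ?_
  rw [Measure.map_apply hV (measurableSet_singleton a), Real.negMulLog, neg_mul, ← mul_neg,
    ENNReal.ofReal_mul ENNReal.toReal_nonneg, ENNReal.ofReal_toReal (measure_ne_top _ _), mul_comm]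

theorem ae_measure_preimage_singleton_ne_zero {Ω α : Type*} [MeasurableSpace Ω]
    [Countable α] (P : Measure Ω) (V : Ω → α) : ∀ᵐ ω ∂P, P (V ⁻¹' {V ω}) ≠ 0 := by
  have h : P (⋃ a ∈ {a | P (V ⁻¹' {a}) = 0}, V ⁻¹' {a}) = 0 :=
    (measure_biUnion_null_iff (Set.to_countable _)).2 fun a ha => ha
  refine measure_mono_null (fun ω hω => ?_) h
  simpa using hω

theorem integrable_mul_log_laplaceSmoothing (hf0 : ∀ x, 0 ≤ f x) (hfm : Measurable f)
    (hf : Integrable f) (hf1 : ∫ x, f x = 1)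
    (hH : discEnt (volume.withDensity fun x => ENNReal.ofReal (f x)) (intFloor d) ≠ ⊤) :
    Integrable fun x => f x * Real.log (laplaceSmoothing f x) := by
  set P := (volume : Measure (Fin d → ℝ)).withDensity fun x => ENNReal.ofReal (f x) with hP
  have hprob : IsProbabilityMeasure P := ⟨by
    rw [hP, withDensity_apply _ .univ, Measure.restrict_univ,
      ← ofReal_integral_eq_lintegral_ofReal hf (.of_forall hf0), hf1, ENNReal.ofReal_one]⟩
  let p (x : Fin d → ℝ) : ℝ := (P (intFloor d ⁻¹' {intFloor d x})).toReal
  have hpm : Measurable p :=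
    (measurable_of_countable fun i => (P (intFloor d ⁻¹' {i})).toReal).comp (measurable_intFloor d)
  have hp1 (x : Fin d → ℝ) : p x ≤ 1 := measureReal_le_one
  have hplog (x : Fin d → ℝ) : 0 ≤ -Real.log (p x) :=
    neg_nonneg.2 (Real.log_nonpos ENNReal.toReal_nonneg (hp1 x))
  have hint : Integrable fun x => f x * -Real.log (p x) := by
    refine ⟨(hfm.mul hpm.log.neg).aestronglyMeasurable, ?_⟩
    rw [hasFiniteIntegral_iff_ofReal (.of_forall fun x => mul_nonneg (hf0 x) (hplog x))]
    have hlogm : Measurable fun x => ENNReal.ofReal (-Real.log (p x)) :=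
      hpm.log.neg.ennreal_ofReal
    have e : ∫⁻ x, ENNReal.ofReal (-Real.log (p x)) ∂P =
        ∫⁻ x, ENNReal.ofReal (f x) * ENNReal.ofReal (-Real.log (p x)) :=
      lintegral_withDensity_eq_lintegral_mul _ hfm.ennreal_ofReal hlogm
    simp only [ENNReal.ofReal_mul (hf0 _)]
    rw [← e, lintegral_neg_log_measure_eq_discEnt P (measurable_intFloor d)]
    exact hH.lt_top
  have hae : ∀ᵐ x, ENNReal.ofReal (f x) ≠ 0 → P (intFloor d ⁻¹' {intFloor d x}) ≠ 0 :=
    (ae_withDensity_iff hfm.ennreal_ofReal).1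
      (ae_measure_preimage_singleton_ne_zero P (intFloor d))
  refine (hf.add hint).mono'
    (hfm.mul (measurable_laplaceSmoothing hfm).log).aestronglyMeasurable ?_
  filter_upwards [hae] with x hx
  rcases (hf0 x).eq_or_lt with h0 | h0
  · simp [← h0]
  have hpx : 0 < p x :=
    ENNReal.toReal_pos (hx (ENNReal.ofReal_pos.2 h0).ne') (measure_ne_top _ _)
  have hle : Real.exp (-1) * p x ≤ laplaceSmoothing f x := by
    have := exp_neg_one_mul_le_laplaceSmoothing hf0 hfm hf x
    rwa [← toReal_withDensity_intFloor_preimage hf0 hf] at this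
  have hlog := Real.log_le_log (by positivity) hle
  rw [Real.log_mul (Real.exp_pos _).ne' hpx.ne', Real.log_exp] at hlog
  rw [norm_mul, Real.norm_of_nonneg (hf0 x), Real.norm_eq_abs, abs_of_nonpos
    (Real.log_nonpos (laplaceSmoothing_pos hf0 hfm hf hf1 x).le
      (laplaceSmoothing_le_one hf0 hf hf1 x))]
  have := mul_le_mul_of_nonneg_left hlog (hf0 x)
  simp only [Pi.add_apply]
  linarith

end ReferenceDensity

/-- `limsup_{D↓0} h(X+Z_D) ≤ h(X)`, where `Z_D` is the generalized-Gaussian noise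
of distortion `D`, independent of `X`, so that `X+Z_D` has density the convolution
of `f_X` and `f_{Z_D}`. -/
theorem limsup_diffEnt_add_noise_le
    (d : ℕ) (hd : 1 ≤ d) (r : ℝ) (hr : 0 < r)
    (ν : Seminorm ℝ (Fin d → ℝ)) (hνdef : ∀ x, ν x = 0 → x = 0)
    (hνcont : Continuous fun x => ν x)
    (fX : (Fin d → ℝ) → ℝ) (hf0 : ∀ x, 0 ≤ fX x) (hfm : Measurable fX)
    (hprob : ∫ x, fX x = 1)
    (hent : Integrable (fun x => fX x * Real.log (fX x)) volume)
    (hH : discEnt (volume.withDensity fun x => ENNReal.ofReal (fX x)) (intFloor d) ≠ ⊤) :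
    ∀ Vd : ℝ, Vd = (volume {x : Fin d → ℝ | ν x ≤ 1}).toReal →
    ∀ fZ : ℝ → (Fin d → ℝ) → ℝ, (∀ D z, fZ D z =
      ((d : ℝ) / r) ^ ((d : ℝ) / r - 1) *
        (Vd * Real.Gamma ((d : ℝ) / r) * D ^ ((d : ℝ) / r))⁻¹ *
        Real.exp (-((d : ℝ) / (r * D)) * ν z ^ r)) →
    -- `g D` is the density of `X + Z_D`: the convolution of `fX` and `fZ D`
    ∀ g : ℝ → (Fin d → ℝ) → ℝ, (∀ D x, g D x = ∫ y, fX (x - y) * fZ D y) →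
    Filter.limsup
        (fun D : ℝ =>
          ((diffEnt (volume.withDensity fun x => ENNReal.ofReal (g D x)) : ℝ) : EReal))
        (𝓝[>] (0 : ℝ)) ≤
      ((diffEnt (volume.withDensity fun x => ENNReal.ofReal (fX x)) : ℝ) : EReal) := by
  intro Vd hVd fZ hfZ g hg
  have hf : Integrable fX := by
    by_contra h
    simp [integral_undef h] at hprob
  have hd0 : (0 : ℝ) < d := by exact_mod_cast hd
  have ha : 0 < (d : ℝ) / r := by positivity
  have hV : 0 < Vd := hVd ▸ Seminorm.volume_le_one_pos hd hνdef hνcont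
  have hG : 0 < Real.Gamma ((d : ℝ) / r) := Real.Gamma_pos_of_pos ha
  set A : ℝ := ((d : ℝ) / r) ^ ((d : ℝ) / r - 1) * (Vd * Real.Gamma ((d : ℝ) / r))⁻¹ with hA
  have hA0 : 0 ≤ A := by positivity
  have hνm : Measurable fun x => ν x := hνcont.measurable
  have hφ : fZ 1 = fun u => A * Real.exp (-((d : ℝ) / r) * ν u ^ r) := by
    ext u
    rw [hfZ]
    simp [hA]
  have hφ0 (u : Fin d → ℝ) : 0 ≤ fZ 1 u := by rw [hφ]; positivity
  have hφm : Measurable (fZ 1) := by rw [hφ]; fun_prop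
  have hφi : Integrable (fZ 1) := by
    rw [hφ]
    exact (Seminorm.integrable_exp_neg_mul_rpow hνdef hνcont hr ha).const_mul A
  have hφ_one : ∫ u, fZ 1 u = 1 := by
    rw [hφ, integral_const_mul, Seminorm.integral_exp_neg_mul_rpow hd hνdef hνcont hr ha, ← hVd,
      Real.Gamma_add_one ha.ne', hA, Real.rpow_sub_one ha.ne']
    have := (Real.rpow_pos_of_pos ha ((d : ℝ) / r)).ne'
    field_simp
  have hφ1 : Integrable fun u => ‖u‖ * fZ 1 u := by
    rw [hφ]
    refine ((Seminorm.integrable_norm_mul_exp_neg_mul_rpow hνdef hνcont hr ha).const_mul A).congr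
      (.of_forall fun u => ?_)
    ring
  have hφM (u : Fin d → ℝ) : fZ 1 u ≤ A := by
    rw [hφ]
    refine mul_le_of_le_one_right hA0 (Real.exp_le_one_iff.2 ?_)
    rw [neg_mul, neg_nonpos]
    exact mul_nonneg ha.le (Real.rpow_nonneg (apply_nonneg ν u) r)
  have hscale {D : ℝ} (hD : 0 < D) : g D = addScaledDensity fX (fZ 1) (D ^ (1 / r)) := by
    ext x
    have hs : 0 < D ^ (1 / r) := Real.rpow_pos_of_pos hD _
    have hsd : (D ^ (1 / r)) ^ d = D ^ ((d : ℝ) / r) := by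
      rw [← Real.rpow_natCast, ← Real.rpow_mul hD.le]
      congr 1
      ring
    have hsr (u : Fin d → ℝ) : ν (D ^ (1 / r) • u) ^ r = D * ν u ^ r := by
      rw [map_smul_eq_mul, Real.norm_of_nonneg hs.le, Real.mul_rpow hs.le (apply_nonneg ν u),
        ← Real.rpow_mul hD.le, one_div_mul_cancel hr.ne', Real.rpow_one]
    have hfs (u : Fin d → ℝ) : fZ D (D ^ (1 / r) • u) = (D ^ ((d : ℝ) / r))⁻¹ * fZ 1 u := by
      rw [hφ, hfZ, hsr, hA, mul_inv _ (D ^ ((d : ℝ) / r))]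
      have : -((d : ℝ) / (r * D)) * (D * ν u ^ r) = -((d : ℝ) / r) * ν u ^ r := by
        field_simp
      rw [this]
      ring
    have h := Measure.integral_comp_smul volume (fun y => fX (x - y) * fZ D y) (D ^ (1 / r))
    simp only [hfs, Module.finrank_fin_fun, hsd, smul_eq_mul] at h
    have hDp : 0 < (D ^ ((d : ℝ) / r))⁻¹ := inv_pos.2 (Real.rpow_pos_of_pos hD _)
    rw [abs_of_pos hDp] at h
    simp only [mul_left_comm _ (D ^ ((d : ℝ) / r))⁻¹, integral_const_mul] at h
    rw [hg, addScaledDensity]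
    exact (mul_left_cancel₀ hDp.ne' h).symm
  have hs0 : Tendsto (fun D : ℝ => D ^ (1 / r)) (𝓝[>] 0) (𝓝[>] 0) := by
    refine tendsto_nhdsWithin_iff.2 ⟨?_, ?_⟩
    · have := (Real.continuousAt_rpow_const 0 (1 / r) (.inr (by positivity))).tendsto
      rw [Real.zero_rpow (by positivity)] at this
      exact this.mono_left nhdsWithin_le_nhds
    · filter_upwards [self_mem_nhdsWithin] with D hD using Real.rpow_pos_of_pos hD _
  rw [diffEnt_withDensity hf0 hfm]
  refine EReal.le_of_forall_lt_iff_le.1 fun b hb => ?_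
  refine limsup_le_of_le (by isBoundedDefault) ?_
  filter_upwards [self_mem_nhdsWithin, hs0.eventually (eventually_entropy_addScaledDensity_lt hf0
    hfm hf hprob hent hφ0 hφm hφi hφ_one hφ1 hφM (laplaceSmoothing_pos hf0 hfm hf hprob)
    (measurable_laplaceSmoothing hfm) (integrable_laplaceSmoothing hf0 hfm hf)
    (abs_log_laplaceSmoothing_add_sub_le hf0 hfm hf hprob)
    (integrable_mul_log_laplaceSmoothing hf0 hfm hf hprob hH)
    (EReal.coe_lt_coe_iff.1 hb))] with D hD hlt
  rw [hscale hD, diffEnt_withDensity (addScaledDensity_nonneg hf0 hφ0 _)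
    (measurable_addScaledDensity hfm hφm _)]
  exact_mod_cast hlt.le
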